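/- For two shift-homogeneous metric spaces X, Y with finite factorizing steps s(X), s(Y), the following are equivalent: (1) X and Y are coarsely equivalent; (2) for some real numbers ε ∈ ss(X) and δ ∈ ss(Y) the components X_ε and Y_δ are coarsely equivalent and X, Y are either both large scale connected or both not large scale connected; (3) for all real numbers ε ∈ ss(X) and δ ∈ ss(Y) the components X_ε and Y_δ are coarsely equivalent and X, Y are either both large scale connected or both not large scale connected. -/

import Mathlib

open scoped ENNReal symmDiff

noncomputable section

/-- The supremum in `ℕ∞` of a set of natural numbers. -/
def natSup (s : Set ℕ) : ℕ∞ := sSup ((↑) '' s : Set ℕ∞)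

/-- The `ε`-connected component of a point `x`: all points linkable to `x` by a chain with
consecutive distances `≤ ε` (for `ε = ∞` this is the whole space). -/
def comp (X : Type*) [MetricSpace X] (ε : ℝ≥0∞) (x : X) : Set X :=
  {y | Relation.ReflTransGen (fun a b => edist a b ≤ ε) x y}

/-- `ss X` is the set of `ε ∈ [0,∞]` such that for every finite `δ ≥ ε` and every point `x` the
set `{X_ε(y) : y ∈ X_δ(x)}` of `ε`-components of points of `X_δ(x)` is finite. -/
def ssSet (X : Type*) [MetricSpace X] : Set ℝ≥0∞ :=
  {ε | ∀ δ : ℝ≥0∞, δ ≠ ⊤ → ε ≤ δ → ∀ x : X, ((comp X ε) '' (comp X δ x)).Finite}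

/-- The factorizing step `s(X) = inf ss(X)`. -/
def sStep (X : Type*) [MetricSpace X] : ℝ≥0∞ := sInf (ssSet X)

/-- A metric space is boundedly-finite if every bounded subset is finite. -/
def BoundedlyFinite (X : Type*) [MetricSpace X] : Prop :=
  ∀ s : Set X, Bornology.IsBounded s → s.Finite

/-- A metric space is homogeneous if for any two points there is a bijective self-isometry
moving one to the other. -/
def Homogeneous (X : Type*) [MetricSpace X] : Prop :=
  ∀ x y : X, ∃ f : X ≃ᵢ X, f x = y

/-- A subset `C` is large scale connected if any two of its points can be linked by an
`ε`-chain for a common finite `ε`. -/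
def IsLSCSet {X : Type*} [MetricSpace X] (C : Set X) : Prop :=
  ∃ ε : ℝ≥0∞, ε ≠ ⊤ ∧ ∀ x ∈ C, ∀ y ∈ C, y ∈ comp X ε x

/-- A metric space is large scale connected if it coincides with an `ε`-connected component
for some finite `ε`. -/
def LargeScaleConnected (X : Type*) [MetricSpace X] : Prop :=
  ∃ ε : ℝ≥0∞, ε ≠ ⊤ ∧ ∀ x y : X, y ∈ comp X ε x

/-- A metric space is shift-homogeneous if any point can be moved to any other point by a
bijective self-isometry whose displacement is bounded on each large scale connected subset. -/
def ShiftHomogeneous (X : Type*) [MetricSpace X] : Prop :=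
  ∀ x y : X, ∃ f : X ≃ᵢ X, f x = y ∧
    ∀ C : Set X, IsLSCSet C → ∃ M : ℝ, ∀ c ∈ C, dist (f c) c ≤ M

/-- The oscillation `ω_f(δ) = sup {d (f x) (f x') : d x x' ≤ δ}` of a map, in `[0,∞]`. -/
def osc {X Y : Type*} [MetricSpace X] [MetricSpace Y] (f : X → Y) (δ : ℝ≥0∞) : ℝ≥0∞ :=
  ⨆ (x : X) (x' : X) (_ : edist x x' ≤ δ), edist (f x) (f x')

/-- A map between metric spaces is coarse if its oscillation at each finite `δ` is finite. -/
def CoarseMapM {X Y : Type*} [MetricSpace X] [MetricSpace Y] (f : X → Y) : Prop :=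
  ∀ δ : ℝ≥0∞, δ ≠ ⊤ → osc f δ ≠ ⊤

/-- Two metric spaces are coarsely isomorphic if there is a bijection between them which is
coarse in both directions. -/
def CoarselyIsomorphic (X Y : Type*) [MetricSpace X] [MetricSpace Y] : Prop :=
  ∃ f : X ≃ Y, CoarseMapM ⇑f ∧ CoarseMapM ⇑f.symm

/-- Two metric spaces are coarsely equivalent if there are coarse maps in both directions whose
compositions are within finite distance of the identities. -/
def CoarselyEquivalent (X Y : Type*) [MetricSpace X] [MetricSpace Y] : Prop :=
  ∃ f : X → Y, CoarseMapM f ∧ ∃ g : Y → X, CoarseMapM g ∧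
    (∃ M : ℝ, ∀ x : X, dist x (g (f x)) ≤ M) ∧ (∃ M : ℝ, ∀ y : Y, dist y (f (g y)) ≤ M)

/-- A metric on a group is left-invariant if left translations are isometries. -/
def LeftInvariantMetric (G : Type*) [Group G] [MetricSpace G] : Prop :=
  ∀ g x y : G, dist (g * x) (g * y) = dist x y

/-- A metric on a countable space is proper if all closed balls are finite. -/
def ProperMetric (X : Type*) [MetricSpace X] : Prop :=
  ∀ (x : X) (r : ℝ), (Metric.closedBall x r).Finite

section Digits

/-- A sequence starting at zero whose consecutive increments are `D` or `D + 1`. -/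
def HasSteps (D : ℕ) (r : ℕ → ℕ) : Prop :=
  r 0 = 0 ∧ ∀ k, r k + D ≤ r (k + 1) ∧ r (k + 1) ≤ r k + D + 1

/-- A strictly increasing sequence of natural numbers starting at `1`, each term dividing
the next one. -/
structure IsTower (K : ℕ → ℕ) : Prop where
  zero : K 0 = 1
  dvd_succ : ∀ n, K n ∣ K (n + 1)
  strictMono : StrictMono K

theorem IsTower.pos {K : ℕ → ℕ} (hK : IsTower K) (n : ℕ) : 0 < K n := by
  have := hK.strictMono.monotone (Nat.zero_le n)
  rw [hK.zero] at this
  omega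

theorem IsTower.lt {K : ℕ → ℕ} (hK : IsTower K) (n : ℕ) : n < K n := by
  induction n with
  | zero => exact hK.pos 0
  | succ n ih => exact (Nat.succ_le_of_lt ih).trans_lt (hK.strictMono n.lt_succ_self)

theorem IsTower.dvd {K : ℕ → ℕ} (hK : IsTower K) {m n : ℕ} (h : m ≤ n) : K m ∣ K n := by
  induction n, h using Nat.le_induction with
  | base => exact dvd_rfl
  | succ n _ ih => exact ih.trans (hK.dvd_succ n)

theorem Nat.div_eq_div_of_dvd {a b p q : ℕ} (hab : a ∣ b) (h : p / a = q / a) :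
    p / b = q / b := by
  obtain ⟨t, rfl⟩ := hab
  rw [← Nat.div_div_eq_div_mul, ← Nat.div_div_eq_div_mul, h]

theorem HasSteps.strictMono {D : ℕ} {r : ℕ → ℕ} (hD : 1 ≤ D) (hr : HasSteps D r) :
    StrictMono r :=
  strictMono_nat_of_lt_succ fun k => by have := (hr.2 k).1; omega

/-- If the multiples of `N` can be reached by sums of `D`s and `D + 1`s in blocks prescribed
by `r`, then they are reached by a sequence with steps `D` and `D + 1`. -/
theorem HasSteps.exists_comp_eq {D E N : ℕ} {r : ℕ → ℕ} (hr : HasSteps E r)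
    (h₁ : (E + 1) * D ≤ N) (h₂ : N ≤ E * (D + 1)) :
    ∃ q, HasSteps D q ∧ ∀ j, q (r j) = N * j := by
  have hb : ∀ i d, r i + d * E ≤ r (i + d) ∧ r (i + d) ≤ r i + d * (E + 1) := by
    intro i d
    induction d with
    | zero => simp
    | succ d ih =>
      have := hr.2 (i + d)
      rw [← add_assoc]
      constructor <;> nlinarith
  have hc : ∀ j, D * r j ≤ N * j := by
    intro j
    have := (hb 0 j).2
    rw [hr.1, zero_add, zero_add] at this
    calc D * r j ≤ D * (j * (E + 1)) := Nat.mul_le_mul_left _ this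
      _ = (E + 1) * D * j := by ring
      _ ≤ N * j := Nat.mul_le_mul_right _ h₁
  let h : ℕ → ℕ := fun k => ⨅ j, (N * j - D * r j + (k - r j))
  have hle : ∀ k j, h k ≤ N * j - D * r j + (k - r j) := fun k j => ciInf_le (OrderBot.bddBelow _) j
  have hex : ∀ k, ∃ j, N * j - D * r j + (k - r j) = h k := fun k =>
    Nat.sInf_mem (Set.range_nonempty _)
  have hval : ∀ i, h (r i) = N * i - D * r i := by
    intro i
    apply le_antisymm
    · simpa using hle (r i) i
    · obtain ⟨j, hj⟩ := hex (r i)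
      rw [← hj]
      rcases le_total i j with hij | hij
      · obtain ⟨d, rfl⟩ := Nat.exists_eq_add_of_le hij
        have h3 : D * r (i + d) ≤ D * r i + N * d :=
          calc D * r (i + d) ≤ D * (r i + d * (E + 1)) := Nat.mul_le_mul_left _ (hb i d).2
            _ = D * r i + (E + 1) * D * d := by ring
            _ ≤ _ := Nat.add_le_add_left (Nat.mul_le_mul_right _ h₁) _
        have h4 := hc i
        rw [mul_add]
        omega
      · obtain ⟨d, rfl⟩ := Nat.exists_eq_add_of_le hij
        have h3 : D * r j + N * d + r j ≤ D * r (j + d) + r (j + d) :=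
          calc D * r j + N * d + r j ≤ D * r j + E * (D + 1) * d + r j := by gcongr
            _ = (D + 1) * (r j + d * E) := by ring
            _ ≤ (D + 1) * r (j + d) := Nat.mul_le_mul_left _ (hb j d).1
            _ = _ := by ring
        have h4 := hc j
        have h5 := hc (j + d)
        have h6 := (hb j d).1
        rw [mul_add] at h5 ⊢
        omega
  refine ⟨fun k => D * k + h k, ⟨?_, fun k => ?_⟩, fun j => ?_⟩
  · have := hval 0
    rw [hr.1] at this
    simpa using this
  · have hmono : h k ≤ h (k + 1) := by
      obtain ⟨j, hj⟩ := hex (k + 1)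
      have := hle k j
      omega
    have hlip : h (k + 1) ≤ h k + 1 := by
      obtain ⟨j, hj⟩ := hex k
      have := hle (k + 1) j
      omega
    simp only [mul_add, mul_one]
    omega
  · have := hc j
    simp only [hval]
    omega

theorem exists_hasSteps_comp_eq_of_lt (n : ℕ) : ∀ D N : ℕ → ℕ,
    (∀ i, (D (i + 1) + 1) * D i ≤ N i ∧ N i ≤ D (i + 1) * (D i + 1)) →
    ∃ r : ℕ → ℕ → ℕ, (∀ i, HasSteps (D i) (r i)) ∧ ∀ i < n, ∀ j, r i (r (i + 1) j) = N i * j := by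
  induction n with
  | zero =>
    intro D N _
    refine ⟨fun i k => D i * k, fun i => ⟨by simp, fun k => ?_⟩, by simp⟩
    simp only [mul_add, mul_one]
    omega
  | succ n ih =>
    intro D N h
    obtain ⟨r, hr, hrN⟩ := ih (fun i => D (i + 1)) (fun i => N (i + 1)) fun i => h (i + 1)
    obtain ⟨q, hq, hqr⟩ := (hr 0).exists_comp_eq (h 0).1 (h 0).2
    refine ⟨fun i => Nat.casesOn i q r, fun i => ?_, fun i hi => ?_⟩
    · cases i with
      | zero => exact hq
      | succ i => exact hr i
    · cases i with
      | zero => exact hqr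
      | succ i => exact hrN i (by omega)

theorem exists_hasSteps_comp_eq (D N : ℕ → ℕ)
    (h : ∀ i, (D (i + 1) + 1) * D i ≤ N i ∧ N i ≤ D (i + 1) * (D i + 1)) :
    ∃ r : ℕ → ℕ → ℕ, (∀ i, HasSteps (D i) (r i)) ∧ ∀ i j, r i (r (i + 1) j) = N i * j := by
  let t : ℕ → Set (ℕ → ℕ → ℕ) := fun n =>
    {r | (∀ i, HasSteps (D i) (r i)) ∧ ∀ i < n, ∀ j, r i (r (i + 1) j) = N i * j}
  have hcl : ∀ n, IsClosed (t n) := by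
    intro n
    have key : t n =
        ((⋂ i, {r | r i 0 = 0}) ∩
          ⋂ i, ⋂ k, {r | r i k + D i ≤ r i (k + 1) ∧ r i (k + 1) ≤ r i k + D i + 1}) ∩
        ⋂ i, ⋂ (_ : i < n), ⋂ j, ⋂ m, {r | r (i + 1) j = m → r i m = N i * j} := by
      ext r
      simp only [t, HasSteps, Set.mem_ofPred_eq, Set.mem_inter_iff, Set.mem_iInter, forall_and,
        forall_eq']
    rw [key]
    refine ((isClosed_iInter fun i => ?_).inter (isClosed_iInter fun i => isClosed_iInter
      fun k => ?_)).inter (isClosed_iInter fun i => isClosed_iInter fun _ => isClosed_iInter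
      fun j => isClosed_iInter fun m => ?_)
    · exact (isClosed_discrete {a : ℕ | a = 0}).preimage
        (f := fun r : ℕ → ℕ → ℕ => r i 0) (by fun_prop)
    · exact (isClosed_discrete {p : ℕ × ℕ | p.1 + D i ≤ p.2 ∧ p.2 ≤ p.1 + D i + 1}).preimage
        (f := fun r : ℕ → ℕ → ℕ => (r i k, r i (k + 1))) (by fun_prop)
    · exact (isClosed_discrete {p : ℕ × ℕ | p.1 = m → p.2 = N i * j}).preimage
        (f := fun r : ℕ → ℕ → ℕ => (r (i + 1) j, r i m)) (by fun_prop)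
  have hcomp : IsCompact (t 0) := by
    refine (isCompact_univ_pi fun i => isCompact_univ_pi fun k =>
      (Set.finite_Iic ((D i + 1) * k)).isCompact).of_isClosed_subset (hcl 0) ?_
    rintro r ⟨hr, -⟩ i - k -
    rw [Set.mem_Iic]
    induction k with
    | zero => simp [(hr i).1]
    | succ k ih =>
      have := ((hr i).2 k).2
      rw [mul_add]
      lia
  obtain ⟨r, hr⟩ := IsCompact.nonempty_iInter_of_sequence_nonempty_isCompact_isClosed t
    (fun n r hr => ⟨hr.1, fun i hi => hr.2 i (by omega)⟩)
    (fun n => exists_hasSteps_comp_eq_of_lt n D N h) hcomp hcl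
  rw [Set.mem_iInter] at hr
  exact ⟨r, (hr 0).1, fun i => (hr (i + 1)).2 i (by omega)⟩

theorem IsTower.exists_ratio {K : ℕ → ℕ} (hK : IsTower K) (n : ℕ) {D : ℕ} (hD : 1 ≤ D) :
    ∃ n' N E, n < n' ∧ K n' = K n * N ∧ 1 ≤ E ∧ (E + 1) * D ≤ N ∧ N ≤ E * (D + 1) := by
  obtain ⟨c, hc⟩ : ∃ c, c = K n * (D * (2 * D + 1)) + n + 1 := ⟨_, rfl⟩
  have hcK : c ≤ K c := hK.strictMono.id_le c
  obtain ⟨N, hN⟩ := hK.dvd (show n ≤ c by omega)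
  have hle : D * (2 * D + 1) ≤ N := by
    refine le_of_mul_le_mul_left ?_ (hK.pos n)
    omega
  have hq : 2 * D + 1 ≤ N / D := by
    rw [Nat.le_div_iff_mul_le hD, mul_comm]
    exact hle
  obtain ⟨E, hE⟩ : ∃ E, N / D = E + 1 := ⟨N / D - 1, by omega⟩
  have h1 : (E + 1) * D ≤ N := hE ▸ Nat.div_mul_le_self N D
  have h2 : N < (E + 1 + 1) * D := hE ▸ (Nat.div_lt_iff_lt_mul hD).1 (Nat.lt_succ_self _)
  refine ⟨c, N, E, by omega, hN, by omega, h1, ?_⟩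
  nlinarith

theorem exists_alternating_ratios {F : ℕ → ℕ → ℕ} (hF : ∀ k, IsTower (F k)) :
    ∃ x D N : ℕ → ℕ, x 0 = 0 ∧ x 1 = 0 ∧ ∀ k, x k < x (k + 2) ∧
      F k (x (k + 2)) = F k (x k) * N k ∧ 1 ≤ D k ∧
      (D (k + 1) + 1) * D k ≤ N k ∧ N k ≤ D (k + 1) * (D k + 1) := by
  choose u N E h using fun (k n : ℕ) (D : {D : ℕ // 1 ≤ D}) => (hF k).exists_ratio n D.2
  let s : ℕ → ℕ × ℕ × {D : ℕ // 1 ≤ D} := fun k => Nat.rec (0, 0, ⟨1, le_rfl⟩)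
    (fun k s => (s.2.1, u k s.1 s.2.2, ⟨E k s.1 s.2.2, (h k s.1 s.2.2).2.2.1⟩)) k
  refine ⟨fun k => (s k).1, fun k => (s k).2.2, fun k => N k (s k).1 (s k).2.2, rfl, rfl,
    fun k => ?_⟩
  have := h k (s k).1 (s k).2.2
  exact ⟨this.1, this.2.1, (s k).2.2.2, this.2.2.2⟩

/-- Any two towers define coarsely equivalent hierarchical partitions of `ℕ`. -/
theorem IsTower.exists_coarse_map {K L : ℕ → ℕ} (hK : IsTower K) (hL : IsTower L) :
    ∃ g : ℕ → ℕ,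
      (∀ i, ∃ j, ∀ m m', m / L i = m' / L i → g m / K j = g m' / K j) ∧
      (∀ i, ∃ j, ∀ m m', g m / K i = g m' / K i → m / L j = m' / L j) ∧
      ∃ j, ∀ t, ∃ m, g m / K j = t / K j := by
  obtain ⟨x, D, N, hx0, hx1, h⟩ := exists_alternating_ratios
    (F := fun k => if Even k then K else L) (fun k => by split_ifs <;> assumption)
  obtain ⟨r, hr, hrN⟩ := exists_hasSteps_comp_eq D N fun i => (h i).2.2.2
  have hKx : ∀ i, K (x (2 * i + 2)) = K (x (2 * i)) * N (2 * i) := fun i => by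
    simpa using (h (2 * i)).2.1
  have hLx : ∀ i, L (x (2 * i + 3)) = L (x (2 * i + 1)) * N (2 * i + 1) := fun i => by
    have := (h (2 * i + 1)).2.1
    rwa [if_neg (by simp)] at this
  have hmono : StrictMono (r 0) := (hr 0).strictMono (h 0).2.2.1
  have key : ∀ i j, r 0 (L (x (2 * i + 1)) * j) = K (x (2 * i)) * r (2 * i) j := by
    intro i
    induction i with
    | zero => simp [hx0, hx1, hK.zero, hL.zero]
    | succ i ih =>
      intro j
      calc r 0 (L (x (2 * i + 3)) * j)
          = r 0 (L (x (2 * i + 1)) * (r (2 * i + 1) (r (2 * i + 2) j))) := by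
            rw [hLx, hrN (2 * i + 1), mul_assoc]
        _ = K (x (2 * i + 2)) * r (2 * i + 2) j := by
            rw [ih, hrN (2 * i), hKx, mul_assoc]
  have key' : ∀ i t, ∃ j, r 0 (L (x (2 * i + 1)) * j) = K (x (2 * i + 2)) * t := fun i t =>
    ⟨r (2 * i + 1) t, by rw [key, hrN, hKx, mul_assoc]⟩
  have hxe : ∀ i, i ≤ x (2 * i) := fun i => by
    induction i with
    | zero => simp
    | succ i ih =>
      have := (h (2 * i)).1
      rw [show 2 * (i + 1) = 2 * i + 2 by ring]
      omega
  have hxo : ∀ i, i ≤ x (2 * i + 1) := fun i => by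
    induction i with
    | zero => simp
    | succ i ih =>
      have := (h (2 * i + 1)).1
      rw [show 2 * (i + 1) + 1 = 2 * i + 1 + 2 by ring]
      omega
  have image_lt : ∀ i m m', r 0 m / K (x (2 * i + 2)) < r 0 m' / K (x (2 * i + 2)) →
      m / L (x (2 * i + 1)) < m' / L (x (2 * i + 1)) := by
    intro i m m' hlt
    obtain ⟨j, hj⟩ := key' i (r 0 m' / K (x (2 * i + 2)))
    have h1 : m < L (x (2 * i + 1)) * j := by
      rw [← hmono.lt_iff_lt, hj, mul_comm]
      exact (Nat.div_lt_iff_lt_mul (hK.pos _)).1 hlt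
    have h2 : L (x (2 * i + 1)) * j ≤ m' := by
      rw [← hmono.le_iff_le, hj]
      exact Nat.mul_div_le _ _
    rw [mul_comm] at h1 h2
    exact ((Nat.div_lt_iff_lt_mul (hL.pos _)).2 h1).trans_le
      ((Nat.le_div_iff_mul_le (hL.pos _)).2 h2)
  have lt_image : ∀ i m m', m / L (x (2 * i + 1)) < m' / L (x (2 * i + 1)) →
      r 0 m / K (x (2 * i)) < r 0 m' / K (x (2 * i)) := by
    intro i m m' hlt
    have h1 := (Nat.div_lt_iff_lt_mul (hL.pos _)).1 hlt
    rw [mul_comm] at h1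
    have h2 := Nat.mul_div_le m' (L (x (2 * i + 1)))
    rw [← hmono.lt_iff_lt, key, mul_comm] at h1
    rw [← hmono.le_iff_le, key, mul_comm] at h2
    exact ((Nat.div_lt_iff_lt_mul (hK.pos _)).2 h1).trans_le
      ((Nat.le_div_iff_mul_le (hK.pos _)).2 h2)
  refine ⟨r 0, fun i => ⟨x (2 * i + 2), fun m m' hm => ?_⟩,
    fun i => ⟨x (2 * i + 1), fun m m' hm => ?_⟩, x 2, fun t => ?_⟩
  · replace hm := Nat.div_eq_div_of_dvd (hL.dvd (hxo i)) hm
    by_contra hne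
    rcases Nat.lt_or_gt_of_ne hne with hlt | hlt
    · exact (image_lt i _ _ hlt).ne hm
    · exact (image_lt i _ _ hlt).ne' hm
  · replace hm := Nat.div_eq_div_of_dvd (hK.dvd (hxe i)) hm
    by_contra hne
    rcases Nat.lt_or_gt_of_ne hne with hlt | hlt
    · exact (lt_image i _ _ hlt).ne hm
    · exact (lt_image i _ _ hlt).ne' hm
  · have hex : ∃ m, t < r 0 m := ⟨t + 1, hmono.id_le (t + 1)⟩
    obtain ⟨m, hm⟩ : ∃ m, Nat.find hex = m + 1 := by
      refine ⟨Nat.find hex - 1, ?_⟩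
      have : Nat.find hex ≠ 0 := fun h0 => by
        have := Nat.find_spec hex
        rw [h0, (hr 0).1] at this
        omega
      omega
    have h1 : r 0 m ≤ t := not_lt.1 (Nat.find_min hex (by omega))
    have h2 : t < r 0 (m + 1) := hm ▸ Nat.find_spec hex
    refine ⟨m, le_antisymm (Nat.div_le_div_right h1) (not_lt.1 fun hlt => ?_)⟩
    obtain ⟨j, hj⟩ := key' 0 (t / K (x 2))
    simp only [mul_zero, zero_add, hx1, hL.zero, one_mul] at hj
    have h3 : r 0 m < r 0 j := by
      rw [hj, mul_comm]
      exact (Nat.div_lt_iff_lt_mul (hK.pos _)).1 hlt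
    have h4 : r 0 j < r 0 (m + 1) := by
      rw [hj]
      exact (Nat.mul_div_le _ _).trans_lt h2
    rw [hmono.lt_iff_lt] at h3 h4
    omega

end Digits

section Spans

/-- Points whose images under `α` are close have images under `β` that are uniformly close. -/
def Controls {Z X Y : Type*} [MetricSpace X] [MetricSpace Y] (α : Z → X) (β : Z → Y) : Prop :=
  ∀ R : ℝ, ∃ S : ℝ, ∀ z z', dist (α z) (α z') ≤ R → dist (β z) (β z') ≤ S

/-- A map with coarsely dense range. -/
def CoarselyOnto {Z X : Type*} [MetricSpace X] (α : Z → X) : Prop :=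
  ∃ M : ℝ, ∀ x, ∃ z, dist x (α z) ≤ M

variable {X Y Z : Type*} [MetricSpace X] [MetricSpace Y]

theorem coarseMapM_iff_controls {f : X → Y} : CoarseMapM f ↔ Controls id f := by
  constructor
  · intro hf R
    have h := hf (ENNReal.ofReal R) ENNReal.ofReal_ne_top
    refine ⟨(osc f (ENNReal.ofReal R)).toReal, fun x x' hx => ?_⟩
    rw [dist_edist (f x)]
    refine ENNReal.toReal_mono h ?_
    have hx' : edist x x' ≤ ENNReal.ofReal R := by
      rw [edist_dist]
      exact ENNReal.ofReal_le_ofReal hx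
    exact le_iSup_of_le x (le_iSup_of_le x' (le_iSup_of_le hx' le_rfl))
  · intro hf δ hδ
    obtain ⟨S, hS⟩ := hf δ.toReal
    refine ne_top_of_le_ne_top (ENNReal.ofReal_ne_top (r := S)) ?_
    refine iSup_le fun x => iSup_le fun x' => iSup_le fun h => ?_
    rw [edist_dist]
    refine ENNReal.ofReal_le_ofReal (hS x x' ?_)
    rw [id, id, dist_edist]
    exact ENNReal.toReal_mono hδ h

theorem CoarselyEquivalent.symm (h : CoarselyEquivalent X Y) : CoarselyEquivalent Y X := by
  obtain ⟨f, hf, g, hg, h₁, h₂⟩ := h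
  exact ⟨g, hg, f, hf, h₂, h₁⟩

theorem CoarselyEquivalent.of_span {α : Z → X} {β : Z → Y} (hα : CoarselyOnto α)
    (hβ : CoarselyOnto β) (hαβ : Controls α β) (hβα : Controls β α) :
    CoarselyEquivalent X Y := by
  obtain ⟨M, hM⟩ := hα
  obtain ⟨N, hN⟩ := hβ
  choose σ hσ using hM
  choose τ hτ using hN
  refine ⟨fun x => β (σ x), ?_, fun y => α (τ y), ?_, ?_, ?_⟩
  · rw [coarseMapM_iff_controls]
    intro R
    obtain ⟨S, hS⟩ := hαβ (M + R + M)
    refine ⟨S, fun x x' hx => hS _ _ ?_⟩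
    have h1 := dist_triangle4 (α (σ x)) x x' (α (σ x'))
    have h2 := hσ x
    have h3 := hσ x'
    rw [dist_comm] at h2
    simp only [id] at hx
    linarith
  · rw [coarseMapM_iff_controls]
    intro R
    obtain ⟨S, hS⟩ := hβα (N + R + N)
    refine ⟨S, fun x x' hx => hS _ _ ?_⟩
    have h1 := dist_triangle4 (β (τ x)) x x' (β (τ x'))
    have h2 := hτ x
    have h3 := hτ x'
    rw [dist_comm] at h2
    simp only [id] at hx
    linarith
  · obtain ⟨S, hS⟩ := hβα N
    refine ⟨M + S, fun x => (dist_triangle _ (α (σ x)) _).trans ?_⟩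
    exact add_le_add (hσ x) (hS _ _ (hτ _))
  · obtain ⟨S, hS⟩ := hαβ M
    refine ⟨N + S, fun y => (dist_triangle _ (β (τ y)) _).trans ?_⟩
    exact add_le_add (hτ y) (hS _ _ (hσ _))

theorem CoarselyEquivalent.exists_map (h : CoarselyEquivalent X Y) :
    ∃ f : X → Y, CoarselyOnto f ∧ Controls id f ∧ Controls f id := by
  obtain ⟨f, hf, g, hg, ⟨M, hM⟩, N, hN⟩ := h
  rw [coarseMapM_iff_controls] at hf hg
  refine ⟨f, ⟨N, fun y => ⟨g y, hN y⟩⟩, hf, fun R => ?_⟩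
  obtain ⟨S, hS⟩ := hg R
  refine ⟨M + S + M, fun x x' hx => ?_⟩
  have h1 := dist_triangle4 x (g (f x)) (g (f x')) x'
  have h2 := hM x
  have h3 := hM x'
  rw [dist_comm] at h3
  have h4 := hS _ _ hx
  simp only [id] at h4 ⊢
  linarith

end Spans

section Components

variable {X : Type*} [MetricSpace X]

theorem mem_comp_self (ε : ℝ≥0∞) (x : X) : x ∈ comp X ε x := Relation.ReflTransGen.refl

theorem mem_comp_of_edist_le {ε : ℝ≥0∞} {x y : X} (h : edist x y ≤ ε) : y ∈ comp X ε x :=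
  Relation.ReflTransGen.single h

theorem mem_comp_trans {ε : ℝ≥0∞} {x y z : X} (h : y ∈ comp X ε x) (h' : z ∈ comp X ε y) :
    z ∈ comp X ε x :=
  Relation.ReflTransGen.trans h h'

theorem mem_comp_symm {ε : ℝ≥0∞} {x y : X} (h : y ∈ comp X ε x) : x ∈ comp X ε y := by
  induction h with
  | refl => exact mem_comp_self ε x
  | tail _ hbc ih => exact mem_comp_trans (mem_comp_of_edist_le ((edist_comm _ _).trans_le hbc)) ih

theorem comp_mono {ε δ : ℝ≥0∞} (h : ε ≤ δ) (x : X) : comp X ε x ⊆ comp X δ x :=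
  fun _ hy => Relation.ReflTransGen.mono (fun _ _ hab => le_trans hab h) _ _ hy

theorem comp_eq_comp {ε : ℝ≥0∞} {x y : X} (h : y ∈ comp X ε x) : comp X ε y = comp X ε x :=
  Set.Subset.antisymm (fun _ hz => mem_comp_trans h hz)
    fun _ hz => mem_comp_trans (mem_comp_symm h) hz

theorem mem_comp_map {Y : Type*} [MetricSpace Y] {f : X → Y} {ε δ : ℝ≥0∞}
    (hf : ∀ a b, edist a b ≤ ε → edist (f a) (f b) ≤ δ) {x y : X} (h : y ∈ comp X ε x) :
    f y ∈ comp Y δ (f x) :=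
  Relation.ReflTransGen.lift f hf _ _ h

theorem mem_comp_isometry_iff (f : X ≃ᵢ X) {ε : ℝ≥0∞} {x y : X} :
    f y ∈ comp X ε (f x) ↔ y ∈ comp X ε x := by
  refine ⟨fun h => ?_, mem_comp_map fun a b hab => by rwa [f.edist_eq]⟩
  simpa using mem_comp_map (f := f.symm) (δ := ε) (fun a b hab => by rwa [f.symm.edist_eq]) h

theorem isLSCSet_comp {ε : ℝ≥0∞} (hε : ε ≠ ⊤) (x : X) : IsLSCSet (comp X ε x) :=
  ⟨ε, hε, fun _ hy _ hz => mem_comp_trans (mem_comp_symm hy) hz⟩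

theorem Controls.exists_mem_comp {Y : Type*} [MetricSpace Y] {f : X → Y} (hf : Controls id f)
    {ε : ℝ≥0∞} (hε : ε ≠ ⊤) :
    ∃ δ : ℝ≥0∞, δ ≠ ⊤ ∧ ∀ x y, y ∈ comp X ε x → f y ∈ comp Y δ (f x) := by
  obtain ⟨S, hS⟩ := hf ε.toReal
  refine ⟨ENNReal.ofReal S, ENNReal.ofReal_ne_top, fun x y => mem_comp_map fun a b hab => ?_⟩
  rw [edist_dist]
  refine ENNReal.ofReal_le_ofReal (hS a b ?_)
  rw [id, id, dist_edist]
  exact ENNReal.toReal_mono hε hab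

theorem mem_ssSet_of_le {ε δ : ℝ≥0∞} (hε : ε ∈ ssSet X) (h : ε ≤ δ) : δ ∈ ssSet X := by
  intro δ' hδ' hle x
  refine ((hε δ' hδ' (h.trans hle) x).image fun s => ⋃ z ∈ s, comp X δ z).subset ?_
  rintro _ ⟨y, hy, rfl⟩
  refine ⟨_, ⟨y, hy, rfl⟩, Set.Subset.antisymm ?_ ?_⟩
  · refine Set.iUnion₂_subset fun z hz => ?_
    rw [comp_eq_comp (comp_mono h y hz)]
  · exact Set.subset_biUnion_of_mem (u := comp X δ) (mem_comp_self ε y)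

theorem exists_mem_ssSet (h : sStep X ≠ ⊤) : ∃ ε : ℝ≥0∞, ε ≠ ⊤ ∧ ε ∈ ssSet X := by
  obtain ⟨ε, hε, hlt⟩ := sInf_lt_iff.1 (lt_top_iff_ne_top.2 h)
  exact ⟨ε, hlt.ne, hε⟩

/-- A larger component of a shift-homogeneous space is tiled by finitely many copies of a
smaller one under isometries which are close to the identity. -/
theorem ShiftHomogeneous.exists_tiling (hX : ShiftHomogeneous X) {ε δ : ℝ≥0∞}
    (hε : ε ∈ ssSet X) (hδ : δ ≠ ⊤) (h : ε ≤ δ) (x₀ : X) :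
    ∃ (k : ℕ) (s : ℕ → X ≃ᵢ X) (M : ℝ), 0 < k ∧ s 0 = IsometryEquiv.refl X ∧
      (∀ i < k, ∀ z ∈ comp X δ x₀, dist (s i z) z ≤ M) ∧
      (∀ i < k, s i x₀ ∈ comp X δ x₀) ∧
      (∀ i < k, ∀ j < k, s j x₀ ∈ comp X ε (s i x₀) → i = j) ∧
      ∀ z ∈ comp X δ x₀, ∃ i < k, z ∈ comp X ε (s i x₀) := by
  set A := comp X ε '' comp X δ x₀
  have hfin : A.Finite := hε δ hδ h x₀
  have := hfin.to_subtype
  let a₀ : A := ⟨comp X ε x₀, x₀, mem_comp_self δ x₀, rfl⟩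
  have hpos : 0 < Nat.card A := Nat.card_pos_iff.2 ⟨⟨a₀⟩, inferInstance⟩
  let i₀ : Fin (Nat.card A) := ⟨0, hpos⟩
  let e₁ : A ≃ Fin (Nat.card A) := Finite.equivFin A
  let e : A ≃ Fin (Nat.card A) := e₁.trans (Equiv.swap (e₁ a₀) i₀)
  have he : e.symm i₀ = a₀ := by
    rw [Equiv.symm_apply_eq]
    exact (Equiv.swap_apply_left _ _).symm
  have hsel : ∀ i : Fin (Nat.card A), ∃ f : X ≃ᵢ X, (i = i₀ → f = IsometryEquiv.refl X) ∧
      f x₀ ∈ comp X δ x₀ ∧ comp X ε (f x₀) = e.symm i ∧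
      ∃ M : ℝ, ∀ z ∈ comp X δ x₀, dist (f z) z ≤ M := by
    intro i
    by_cases hi : i = i₀
    · subst hi
      exact ⟨IsometryEquiv.refl X, fun _ => rfl, mem_comp_self _ _, by rw [he]; rfl, 0,
        fun z _ => (dist_self z).le⟩
    · obtain ⟨y, hy, hye⟩ := (e.symm i).2
      obtain ⟨f, hf, hb⟩ := hX x₀ y
      exact ⟨f, fun h => absurd h hi, hf ▸ hy, hf ▸ hye, hb _ (isLSCSet_comp hδ x₀)⟩
  choose f hf₀ hfm hfe M hM using hsel
  obtain ⟨B, hB⟩ := (Set.finite_range M).bddAbove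
  refine ⟨Nat.card A, fun i => if hi : i < Nat.card A then f ⟨i, hi⟩ else f i₀, B, hpos, ?_,
    fun i hi z hz => ?_, fun i hi => ?_, fun i hi j hj hij => ?_, fun z hz => ?_⟩
  · exact (dif_pos hpos).trans (hf₀ _ rfl)
  · simp only [dif_pos hi]
    exact (hM _ z hz).trans (hB ⟨_, rfl⟩)
  · simp only [dif_pos hi]
    exact hfm _
  · simp only [dif_pos hi, dif_pos hj] at hij
    have := comp_eq_comp hij
    rw [hfe, hfe] at this
    exact (congrArg Fin.val (e.symm.injective (Subtype.ext this))).symm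
  · refine ⟨e ⟨comp X ε z, z, hz, rfl⟩, Fin.is_lt _, ?_⟩
    simp only [Fin.is_lt, dif_pos, Fin.eta]
    rw [hfe, Equiv.symm_apply_apply]
    exact mem_comp_self _ _

theorem ShiftHomogeneous.comp_coarsely_dense (hX : ShiftHomogeneous X) {ε δ : ℝ≥0∞}
    (hε : ε ∈ ssSet X) (hδ : δ ≠ ⊤) (x₀ : X) :
    ∃ M : ℝ, ∀ z ∈ comp X δ x₀, ∃ w ∈ comp X ε x₀, dist z w ≤ M := by
  rcases le_total δ ε with h | h
  · exact ⟨0, fun z hz => ⟨z, comp_mono h _ hz, by simp⟩⟩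
  obtain ⟨k, s, M, -, -, hM, -, -, hcov⟩ := hX.exists_tiling hε hδ h x₀
  refine ⟨M, fun z hz => ?_⟩
  obtain ⟨i, hi, hzi⟩ := hcov z hz
  have hw : (s i).symm z ∈ comp X ε x₀ := by
    rw [← mem_comp_isometry_iff (s i)]
    simpa using hzi
  refine ⟨_, hw, ?_⟩
  simpa using hM i hi _ (comp_mono h _ hw)

end Components

section Invariance

variable {X Y : Type*} [MetricSpace X] [MetricSpace Y]

theorem LargeScaleConnected.of_coarselyEquivalent (h : CoarselyEquivalent X Y)
    (hX : LargeScaleConnected X) : LargeScaleConnected Y := by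
  obtain ⟨f, ⟨M, hM⟩, hf, -⟩ := h.exists_map
  obtain ⟨ε, hε, hconn⟩ := hX
  obtain ⟨δ, hδ, hfδ⟩ := hf.exists_mem_comp hε
  refine ⟨max δ (ENNReal.ofReal M), max_ne_top hδ ENNReal.ofReal_ne_top, fun y y' => ?_⟩
  have key : ∀ y, ∃ x, f x ∈ comp Y (max δ (ENNReal.ofReal M)) y := fun y => by
    obtain ⟨x, hx⟩ := hM y
    refine ⟨x, mem_comp_of_edist_le (le_max_of_le_right ?_)⟩
    rw [edist_dist]
    exact ENNReal.ofReal_le_ofReal hx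
  obtain ⟨x, hx⟩ := key y
  obtain ⟨x', hx'⟩ := key y'
  exact mem_comp_trans hx (mem_comp_trans
    (comp_mono (le_max_left _ _) _ (hfδ x x' (hconn x x'))) (mem_comp_symm hx'))

theorem CoarselyEquivalent.comp_of_shiftHomogeneous (h : CoarselyEquivalent X Y)
    (hX : ShiftHomogeneous X) (hY : ShiftHomogeneous Y) {ε δ : ℝ≥0∞} (hε : ε ≠ ⊤) (hδ : δ ≠ ⊤)
    (hεX : ε ∈ ssSet X) (hδY : δ ∈ ssSet Y) (x₀ : X) (y₀ : Y) :
    CoarselyEquivalent (comp X ε x₀) (comp Y δ y₀) := by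
  obtain ⟨f', hf'M, hf', hf'i⟩ := h.exists_map
  obtain ⟨σ, hσ, -⟩ := hY (f' x₀) y₀
  obtain ⟨f, hf₀, ⟨M, hM⟩, hf, hfi⟩ : ∃ f : X → Y, f x₀ = y₀ ∧ CoarselyOnto f ∧
      Controls id f ∧ Controls f id := by
    refine ⟨fun x => σ (f' x), hσ, ?_, ?_, ?_⟩
    · obtain ⟨M, hM⟩ := hf'M
      refine ⟨M, fun y => ?_⟩
      obtain ⟨x, hx⟩ := hM (σ.symm y)
      refine ⟨x, ?_⟩
      rwa [← σ.dist_eq, σ.apply_symm_apply] at hx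
    · simpa only [Controls, σ.dist_eq] using hf'
    · simpa only [Controls, σ.dist_eq] using hf'i
  obtain ⟨δ', hδ', hfδ⟩ := hf.exists_mem_comp hε
  obtain ⟨A, hA⟩ := hY.comp_coarsely_dense hδY hδ' y₀
  choose g hg using hM
  obtain ⟨S, hS⟩ := hfi M
  have hgc : Controls id g := by
    intro R
    obtain ⟨T, hT⟩ := hfi (M + R + M)
    refine ⟨T, fun y y' hy => hT _ _ ?_⟩
    have h1 := dist_triangle4 (f (g y)) y y' (f (g y'))
    have h2 := hg y
    have h3 := hg y'
    rw [dist_comm] at h2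
    simp only [id] at hy
    linarith
  obtain ⟨ε', hε', hgε⟩ := hgc.exists_mem_comp hδ
  have hgx₀ : g y₀ ∈ comp X (ENNReal.ofReal S) x₀ := by
    refine mem_comp_of_edist_le ?_
    rw [edist_dist]
    exact ENNReal.ofReal_le_ofReal (hS x₀ (g y₀) (hf₀ ▸ hg y₀))
  obtain ⟨B, hB⟩ := hX.comp_coarsely_dense hεX (δ := max ε' (ENNReal.ofReal S))
    (max_ne_top hε' ENNReal.ofReal_ne_top) x₀
  obtain ⟨T, hT⟩ := hf B
  let C := max A (M + T)
  refine CoarselyEquivalent.of_span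
    (Z := {p : comp X ε x₀ × comp Y δ y₀ // dist (f p.1) p.2 ≤ C})
    (α := fun p => p.1.1) (β := fun p => p.1.2) ⟨0, fun x => ?_⟩ ⟨0, fun y => ?_⟩
    (fun R => ?_) (fun R => ?_)
  · obtain ⟨w, hw, hd⟩ := hA (f x) (hf₀ ▸ hfδ x₀ x x.2)
    exact ⟨⟨(x, ⟨w, hw⟩), hd.trans (le_max_left _ _)⟩, by simp⟩
  · have hgy : g y ∈ comp X (max ε' (ENNReal.ofReal S)) x₀ :=
      mem_comp_trans (comp_mono (le_max_right _ _) _ hgx₀)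
        (comp_mono (le_max_left _ _) _ (hgε y₀ y y.2))
    obtain ⟨w, hw, hd⟩ := hB _ hgy
    refine ⟨⟨(⟨w, hw⟩, y), le_trans ?_ (le_max_right _ _)⟩, by simp⟩
    have h1 := dist_triangle (y : Y) (f (g y)) (f w)
    have h2 := hT (g y) w hd
    have h3 := hg y
    rw [dist_comm]
    linarith
  · obtain ⟨S', hS'⟩ := hf R
    refine ⟨C + S' + C, fun p q hpq => ?_⟩
    have h1 := dist_triangle4 (p.1.2 : Y) (f p.1.1) (f q.1.1) q.1.2
    have h2 := p.2
    have h3 := q.2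
    have h4 := hS' p.1.1 q.1.1 hpq
    rw [dist_comm] at h2
    rw [Subtype.dist_eq]
    linarith
  · obtain ⟨S', hS'⟩ := hfi (C + R + C)
    refine ⟨S', fun p q hpq => hS' p.1.1 q.1.1 ?_⟩
    have h1 := dist_triangle4 (f p.1.1) (p.1.2 : Y) (q.1.2 : Y) (f q.1.1)
    have h2 := p.2
    have h3 := q.2
    rw [dist_comm] at h3
    rw [Subtype.dist_eq] at hpq
    linarith

/-- Large scale connected spaces are coarsely equivalent as soon as their components are. -/
theorem CoarselyEquivalent.of_comp_of_largeScaleConnected (hX : ShiftHomogeneous X)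
    (hY : ShiftHomogeneous Y) {ε δ : ℝ≥0∞} (hεX : ε ∈ ssSet X) (hδY : δ ∈ ssSet Y)
    {x₀ : X} {y₀ : Y} (h : CoarselyEquivalent (comp X ε x₀) (comp Y δ y₀))
    (hXc : LargeScaleConnected X) (hYc : LargeScaleConnected Y) : CoarselyEquivalent X Y := by
  obtain ⟨f, ⟨M, hM⟩, hf, hfi⟩ := h.exists_map
  obtain ⟨ε', hε', hXε⟩ := hXc
  obtain ⟨δ', hδ', hYδ⟩ := hYc
  obtain ⟨A, hA⟩ := hX.comp_coarsely_dense hεX hε' x₀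
  obtain ⟨B, hB⟩ := hY.comp_coarsely_dense hδY hδ' y₀
  refine CoarselyEquivalent.of_span (Z := comp X ε x₀) (α := fun z => z) (β := fun z => f z)
    ⟨A, fun x => ?_⟩ ⟨B + M, fun y => ?_⟩ hf hfi
  · obtain ⟨w, hw, hd⟩ := hA x (hXε _ _)
    exact ⟨⟨w, hw⟩, hd⟩
  · obtain ⟨w, hw, hd⟩ := hB y (hYδ _ _)
    obtain ⟨z, hz⟩ := hM ⟨w, hw⟩
    exact ⟨z, (dist_triangle _ w _).trans (add_le_add hd hz)⟩

end Invariance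

section Towers

variable {X Y : Type*} [MetricSpace X] [MetricSpace Y]

/-- `φ` exhibits `X` as the union of copies of `C` indexed by `ℕ`, where the indices of copies
at bounded distance lie in a common block of bounded size, and the copies of a block are
uniformly close to each other. -/
structure IsTowerParam {C : Type*} [MetricSpace C] (K : ℕ → ℕ) (φ : C × ℕ → X) : Prop where
  surjective : Function.Surjective φ
  dist_le : ∀ n, ∃ M : ℝ, ∀ a b : C × ℕ, a.2 / K n = b.2 / K n →
    |dist (φ a) (φ b) - dist a.1 b.1| ≤ M
  div_eq : ∀ R : ℝ, ∃ n, ∀ a b : C × ℕ, dist (φ a) (φ b) ≤ R → a.2 / K n = b.2 / K n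

theorem Nat.div_eq_div_iff_mod_div {a b p q : ℕ} (hab : a ∣ b) (ha : 0 < a)
    (h : p / b = q / b) : p / a = q / a ↔ p % b / a = q % b / a := by
  obtain ⟨t, rfl⟩ := hab
  have key : ∀ p, p / a = t * (p / (a * t)) + p % (a * t) / a := fun p => by
    conv_lhs => rw [← Nat.div_add_mod p (a * t), mul_assoc, Nat.mul_add_div ha]
  rw [key p, key q, h]
  omega

/-- The composition of the shifts `s n i` prescribed by the digits `i` of `p` below `N` in the
mixed radix system with place values `K`. -/
def digitShift (K : ℕ → ℕ) (s : ℕ → ℕ → X ≃ᵢ X) : ℕ → ℕ → X ≃ᵢ X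
  | 0, _ => IsometryEquiv.refl X
  | N + 1, p => (digitShift K s N (p % K N)).trans (s N (p / K N))

theorem digitShift_eq_of_le {K : ℕ → ℕ} (hK : IsTower K) {s : ℕ → ℕ → X ≃ᵢ X}
    (hs : ∀ n, s n 0 = IsometryEquiv.refl X) {m n p : ℕ} (h : m ≤ n) (hp : p < K m) :
    digitShift K s n p = digitShift K s m p := by
  induction n, h using Nat.le_induction with
  | base => rfl
  | succ n hmn ih =>
    have hpn : p < K n := hp.trans_le (hK.strictMono.monotone hmn)
    rw [digitShift, Nat.mod_eq_of_lt hpn, Nat.div_eq_of_lt hpn, hs, ih]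
    rfl

/-- A chain of tilings of growing components, as provided by `ShiftHomogeneous.exists_tiling`. -/
structure IsTilingChain (e : ℕ → ℝ≥0∞) (x₀ : X) (K : ℕ → ℕ) (s : ℕ → ℕ → X ≃ᵢ X)
    (k : ℕ → ℕ) (M : ℕ → ℝ) : Prop where
  mono : Monotone e
  isTower : IsTower K
  succ : ∀ n, K (n + 1) = K n * k n
  refl : ∀ n, s n 0 = IsometryEquiv.refl X
  dist_le : ∀ n, ∀ i < k n, ∀ z ∈ comp X (e (n + 1)) x₀, dist (s n i z) z ≤ M n
  mem : ∀ n, ∀ i < k n, s n i x₀ ∈ comp X (e (n + 1)) x₀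
  disj : ∀ n, ∀ i < k n, ∀ j < k n, s n j x₀ ∈ comp X (e n) (s n i x₀) → i = j
  cover : ∀ n, ∀ z ∈ comp X (e (n + 1)) x₀, ∃ i < k n, z ∈ comp X (e n) (s n i x₀)

namespace IsTilingChain

variable {e : ℕ → ℝ≥0∞} {x₀ : X} {K : ℕ → ℕ} {s : ℕ → ℕ → X ≃ᵢ X} {k : ℕ → ℕ} {M : ℕ → ℝ}

theorem div_lt (h : IsTilingChain e x₀ K s k M) {N p : ℕ} (hp : p < K (N + 1)) :
    p / K N < k N := by
  rw [h.succ, mul_comm] at hp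
  exact (Nat.div_lt_iff_lt_mul (h.isTower.pos N)).2 hp

theorem mod_lt (h : IsTilingChain e x₀ K s k M) (N p : ℕ) : p % K N < K N :=
  Nat.mod_lt _ (h.isTower.pos N)

theorem digitShift_mem (h : IsTilingChain e x₀ K s k M) {N : ℕ} :
    ∀ {p : ℕ}, p < K N → ∀ c ∈ comp X (e 0) x₀, digitShift K s N p c ∈ comp X (e N) x₀ := by
  induction N with
  | zero => exact fun _ c hc => hc
  | succ N ih =>
    intro p hp c hc
    have h1 := ih (h.mod_lt N p) c hc
    rw [← mem_comp_isometry_iff (s N (p / K N))] at h1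
    exact mem_comp_trans (h.mem N _ (h.div_lt hp)) (comp_mono (h.mono N.le_succ) _ h1)

theorem exists_digitShift_eq (h : IsTilingChain e x₀ K s k M) {N : ℕ} :
    ∀ z ∈ comp X (e N) x₀, ∃ p < K N, ∃ c ∈ comp X (e 0) x₀, digitShift K s N p c = z := by
  induction N with
  | zero => exact fun z hz => ⟨0, h.isTower.pos 0, z, hz, rfl⟩
  | succ N ih =>
    intro z hz
    obtain ⟨i, hi, hzi⟩ := h.cover N z hz
    have h1 : (s N i).symm z ∈ comp X (e N) x₀ := by
      rw [← mem_comp_isometry_iff (s N i)]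
      simpa using hzi
    obtain ⟨p, hp, c, hc, hpc⟩ := ih _ h1
    refine ⟨K N * i + p, ?_, c, hc, ?_⟩
    · rw [h.succ]
      calc K N * i + p < K N * i + K N := by omega
        _ = K N * (i + 1) := by ring
        _ ≤ K N * k N := Nat.mul_le_mul_left _ hi
    · rw [digitShift, Nat.mul_add_mod, Nat.mod_eq_of_lt hp, Nat.mul_add_div (h.isTower.pos N),
        Nat.div_eq_of_lt hp, add_zero, IsometryEquiv.trans_apply, hpc,
        IsometryEquiv.apply_symm_apply]

theorem exists_dist_le (h : IsTilingChain e x₀ K s k M) (N : ℕ) :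
    ∃ B : ℝ, ∀ p < K N, ∀ c ∈ comp X (e 0) x₀, dist (digitShift K s N p c) c ≤ B := by
  induction N with
  | zero => exact ⟨0, fun p _ c _ => (dist_self c).le⟩
  | succ N ih =>
    obtain ⟨B, hB⟩ := ih
    refine ⟨M N + B, fun p hp c hc => (dist_triangle _ _ _).trans (add_le_add ?_
      (hB _ (h.mod_lt N p) c hc))⟩
    exact h.dist_le N _ (h.div_lt hp) _
      (comp_mono (h.mono N.le_succ) _ (h.digitShift_mem (h.mod_lt N p) c hc))

theorem dist_digitShift_le (h : IsTilingChain e x₀ K s k M) (n : ℕ) :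
    ∃ B : ℝ, ∀ N, n ≤ N → ∀ p < K N, ∀ q < K N, ∀ c ∈ comp X (e 0) x₀,
      ∀ d ∈ comp X (e 0) x₀, p / K n = q / K n →
      |dist (digitShift K s N p c) (digitShift K s N q d) - dist c d| ≤ B := by
  obtain ⟨B, hB⟩ := h.exists_dist_le n
  refine ⟨B + B, fun N hN => ?_⟩
  induction N, hN using Nat.le_induction with
  | base =>
    intro p hp q hq c hc d hd _
    have h1 := hB p hp c hc
    have h2 := hB q hq d hd
    have h3 := dist_triangle4 (digitShift K s n p c) c d (digitShift K s n q d)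
    have h4 := dist_triangle4 c (digitShift K s n p c) (digitShift K s n q d) d
    rw [dist_comm d] at h3
    rw [dist_comm c (digitShift K s n p c)] at h4
    rw [abs_le]
    constructor <;> linarith
  | succ N hN ih =>
    intro p hp q hq c hc d hd hpq
    have hdvd := h.isTower.dvd hN
    have hN' := Nat.div_eq_div_of_dvd hdvd hpq
    have := ih _ (h.mod_lt N p) _ (h.mod_lt N q) c hc d hd
      ((Nat.div_eq_div_iff_mod_div hdvd (h.isTower.pos n) hN').1 hpq)
    rwa [digitShift, digitShift, hN', IsometryEquiv.trans_apply, IsometryEquiv.trans_apply,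
      IsometryEquiv.dist_eq]

theorem div_eq_of_mem_comp (h : IsTilingChain e x₀ K s k M) {n N : ℕ} (hN : n ≤ N) :
    ∀ p < K N, ∀ q < K N, ∀ c ∈ comp X (e 0) x₀, ∀ d ∈ comp X (e 0) x₀,
      digitShift K s N q d ∈ comp X (e n) (digitShift K s N p c) → p / K n = q / K n := by
  induction N, hN using Nat.le_induction with
  | base =>
    intro p hp q hq _ _ _ _ _
    rw [Nat.div_eq_of_lt hp, Nat.div_eq_of_lt hq]
  | succ N hN ih =>
    intro p hp q hq c hc d hd hmem
    have hc' := h.digitShift_mem (h.mod_lt N p) c hc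
    have hd' := h.digitShift_mem (h.mod_lt N q) d hd
    rw [← mem_comp_isometry_iff (s N (p / K N))] at hc'
    rw [← mem_comp_isometry_iff (s N (q / K N))] at hd'
    have hN' : p / K N = q / K N := h.disj N _ (h.div_lt hp) _ (h.div_lt hq)
      (mem_comp_trans hc' (mem_comp_trans (comp_mono (h.mono hN) _ hmem) (mem_comp_symm hd')))
    rw [Nat.div_eq_div_iff_mod_div (h.isTower.dvd hN) (h.isTower.pos n) hN']
    refine ih _ (h.mod_lt N p) _ (h.mod_lt N q) c hc d hd ?_
    rwa [digitShift, digitShift, hN', IsometryEquiv.trans_apply, IsometryEquiv.trans_apply,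
      mem_comp_isometry_iff] at hmem

theorem isTowerParam (h : IsTilingChain e x₀ K s k M) (he : ∀ n : ℕ, (n : ℝ≥0∞) ≤ e n) :
    IsTowerParam K (fun a : comp X (e 0) x₀ × ℕ => digitShift K s a.2 a.2 a.1) := by
  have hshift : ∀ {p n : ℕ}, p ≤ n → digitShift K s p p = digitShift K s n p := fun hp =>
    (digitShift_eq_of_le h.isTower h.refl hp (h.isTower.lt _)).symm
  refine ⟨fun z => ?_, fun n => ?_, fun R => ⟨⌈R⌉₊, ?_⟩⟩
  · obtain ⟨N, hN⟩ := exists_nat_gt (dist x₀ z)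
    have hz : z ∈ comp X (e N) x₀ := by
      refine mem_comp_of_edist_le (le_trans ?_ (he N))
      rw [edist_dist, ← ENNReal.ofReal_natCast]
      exact ENNReal.ofReal_le_ofReal hN.le
    obtain ⟨p, hp, c, hc, rfl⟩ := h.exists_digitShift_eq z hz
    refine ⟨(⟨c, hc⟩, p), ?_⟩
    rcases le_total p N with hpN | hpN
    · rw [hshift hpN]
    · rw [digitShift_eq_of_le h.isTower h.refl hpN hp]
  · obtain ⟨B, hB⟩ := h.dist_digitShift_le n
    refine ⟨B, ?_⟩
    rintro ⟨c, p⟩ ⟨d, q⟩ hpq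
    have hp : p ≤ max n (max p q) := by omega
    have hq : q ≤ max n (max p q) := by omega
    have := hB _ (le_max_left n (max p q)) p (hp.trans_lt (h.isTower.lt _)) q
      (hq.trans_lt (h.isTower.lt _)) c c.2 d d.2 hpq
    rwa [← hshift hp, ← hshift hq] at this
  · rintro ⟨c, p⟩ ⟨d, q⟩ hpq
    have hp : p ≤ max ⌈R⌉₊ (max p q) := by omega
    have hq : q ≤ max ⌈R⌉₊ (max p q) := by omega
    refine h.div_eq_of_mem_comp (le_max_left _ (max p q)) p (hp.trans_lt (h.isTower.lt _)) q
      (hq.trans_lt (h.isTower.lt _)) c c.2 d d.2 (mem_comp_of_edist_le (le_trans ?_ (he _)))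
    rw [← hshift hp, ← hshift hq, edist_dist, ← ENNReal.ofReal_natCast]
    exact ENNReal.ofReal_le_ofReal (hpq.trans (Nat.le_ceil R))

end IsTilingChain

theorem ShiftHomogeneous.exists_isTowerParam (hX : ShiftHomogeneous X) {ε : ℝ≥0∞} (hε : ε ≠ ⊤)
    (hεX : ε ∈ ssSet X) (hconn : ¬ LargeScaleConnected X) (x₀ : X) :
    ∃ K, IsTower K ∧ ∃ φ : comp X ε x₀ × ℕ → X, IsTowerParam K φ := by
  have hout : ∀ δ : {δ : ℝ≥0∞ // δ ≠ ⊤}, ∃ y, y ∉ comp X δ x₀ := by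
    rintro ⟨δ, hδ⟩
    by_contra! hall
    exact hconn ⟨δ, hδ, fun x y => mem_comp_trans (mem_comp_symm (hall x)) (hall y)⟩
  choose y hy using hout
  let e : ℕ → {δ : ℝ≥0∞ // δ ≠ ⊤} := fun n => Nat.rec ⟨ε, hε⟩
    (fun _ δ => ⟨max (δ.1 + 1) (edist x₀ (y δ)),
      max_ne_top (ENNReal.add_ne_top.2 ⟨δ.2, ENNReal.one_ne_top⟩) (edist_ne_top _ _)⟩) n
  have he_succ : ∀ n : ℕ, (e (n + 1)).1 =
      max ((e n).1 + 1) (edist x₀ (y (e n))) := fun n => rfl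
  have hmono : Monotone fun n : ℕ => (e n).1 := monotone_nat_of_le_succ fun n => by
    rw [he_succ]
    exact le_max_of_le_left le_self_add
  have hcast : ∀ n : ℕ, (n : ℝ≥0∞) ≤ (e n).1 := fun n => by
    induction n with
    | zero => simp
    | succ n ih =>
      rw [he_succ, Nat.cast_succ]
      exact le_max_of_le_left (by gcongr)
  choose k s M hk hs hM hmem hdisj hcover using fun n => hX.exists_tiling
    (mem_ssSet_of_le hεX (hmono (Nat.zero_le n))) (e (n + 1)).2 (hmono n.le_succ) x₀
  have hk₂ : ∀ n, 1 < k n := by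
    intro n
    obtain ⟨i, hi, hyi⟩ := hcover n (y (e n))
      (mem_comp_of_edist_le ((le_max_right _ _).trans_eq (he_succ n).symm))
    have hi₀ : i ≠ 0 := by
      rintro rfl
      rw [hs] at hyi
      exact hy _ hyi
    omega
  have hK : IsTower fun n => ∏ i ∈ Finset.range n, k i := by
    refine ⟨by simp, fun n => ?_, strictMono_nat_of_lt_succ fun n => ?_⟩
    · rw [Finset.prod_range_succ]
      exact dvd_mul_right _ _
    · rw [Finset.prod_range_succ]
      exact lt_mul_of_one_lt_right (Finset.prod_pos fun i _ => hk i) (hk₂ n)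
  have hchain : IsTilingChain (fun n => (e n).1) x₀ (fun n => ∏ i ∈ Finset.range n, k i)
      s k M :=
    { mono := hmono
      isTower := hK
      succ := fun n => Finset.prod_range_succ _ _
      refl := hs
      dist_le := hM
      mem := hmem
      disj := hdisj
      cover := hcover }
  exact ⟨_, hK, _, hchain.isTowerParam hcast⟩

theorem CoarselyEquivalent.of_isTowerParam {C D : Type*} [MetricSpace C] [MetricSpace D]
    (h : CoarselyEquivalent C D) {K L : ℕ → ℕ} (hK : IsTower K) (hL : IsTower L)
    {φ : C × ℕ → X} {ψ : D × ℕ → Y} (hφ : IsTowerParam K φ) (hψ : IsTowerParam L ψ) :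
    CoarselyEquivalent X Y := by
  obtain ⟨g, ⟨M, hM⟩, hg, hgi⟩ := h.symm.exists_map
  obtain ⟨r, hr, hri, j, hrj⟩ := hK.exists_coarse_map hL
  refine CoarselyEquivalent.symm (CoarselyEquivalent.of_span (α := ψ)
    (β := fun a => φ (g a.1, r a.2)) ?_ ?_ (fun R => ?_) (fun R => ?_))
  · refine ⟨0, fun y => ?_⟩
    obtain ⟨a, rfl⟩ := hψ.surjective y
    exact ⟨a, by simp⟩
  · obtain ⟨B, hB⟩ := hφ.dist_le j
    refine ⟨M + B, fun x => ?_⟩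
    obtain ⟨⟨c, t⟩, rfl⟩ := hφ.surjective x
    obtain ⟨d, hd⟩ := hM c
    obtain ⟨m, hm⟩ := hrj t
    refine ⟨(d, m), ?_⟩
    have := (abs_le.1 (hB (c, t) (g d, r m) hm.symm)).2
    simp only at this ⊢
    linarith
  · obtain ⟨n, hn⟩ := hψ.div_eq R
    obtain ⟨A, hA⟩ := hψ.dist_le n
    obtain ⟨i, hi⟩ := hr n
    obtain ⟨B, hB⟩ := hφ.dist_le i
    obtain ⟨S, hS⟩ := hg (R + A)
    refine ⟨S + B, fun a b hab => ?_⟩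
    have h1 := (abs_le.1 (hA a b (hn a b hab))).1
    have h2 := hS a.1 b.1 (by simp only [id]; linarith)
    have h3 := (abs_le.1 (hB (g a.1, r a.2) (g b.1, r b.2) (hi _ _ (hn a b hab)))).2
    simp only at h3
    linarith
  · obtain ⟨n, hn⟩ := hφ.div_eq R
    obtain ⟨A, hA⟩ := hφ.dist_le n
    obtain ⟨i, hi⟩ := hri n
    obtain ⟨B, hB⟩ := hψ.dist_le i
    obtain ⟨S, hS⟩ := hgi (R + A)
    refine ⟨S + B, fun a b hab => ?_⟩
    have h0 := hn _ _ hab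
    have h1 := (abs_le.1 (hA _ _ h0)).1
    have h2 := hS a.1 b.1 (by simp only at h1; linarith)
    have h3 := (abs_le.1 (hB a b (hi _ _ h0))).2
    simp only [id] at h2
    linarith

end Towers

theorem CoarselyEquivalent.of_comp {X Y : Type*} [MetricSpace X] [MetricSpace Y]
    (hX : ShiftHomogeneous X) (hY : ShiftHomogeneous Y) {ε δ : ℝ≥0∞} (hε : ε ≠ ⊤) (hδ : δ ≠ ⊤)
    (hεX : ε ∈ ssSet X) (hδY : δ ∈ ssSet Y) {x₀ : X} {y₀ : Y}
    (h : CoarselyEquivalent (comp X ε x₀) (comp Y δ y₀))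
    (hconn : LargeScaleConnected X ↔ LargeScaleConnected Y) : CoarselyEquivalent X Y := by
  by_cases hc : LargeScaleConnected X
  · exact .of_comp_of_largeScaleConnected hX hY hεX hδY h hc (hconn.1 hc)
  · obtain ⟨K, hK, φ, hφ⟩ := hX.exists_isTowerParam hε hεX hc x₀
    obtain ⟨L, hL, ψ, hψ⟩ := hY.exists_isTowerParam hδ hδY (mt hconn.2 hc) y₀
    exact h.of_isTowerParam hK hL hφ hψ

/-- Theorem 6.2: for shift-homogeneous metric spaces `X, Y` with finite factorizing steps the
following are equivalent: (1) `X` and `Y` are coarsely equivalent; (2) for some finite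
`ε ∈ ss(X)`, `δ ∈ ss(Y)` the components `X_ε`, `Y_δ` are coarsely equivalent and `X, Y` are
both or neither large scale connected; (3) the same for all finite `ε ∈ ss(X)`, `δ ∈ ss(Y)`. -/
theorem coarse_equivalence_of_shift_homogeneous_spaces_tfae
    (X Y : Type*) [MetricSpace X] [MetricSpace Y]
    (hX : ShiftHomogeneous X) (hY : ShiftHomogeneous Y)
    (hsX : sStep X ≠ ⊤) (hsY : sStep Y ≠ ⊤) (x₀ : X) (y₀ : Y) :
    (CoarselyEquivalent X Y ↔
      (∃ ε δ : ℝ≥0∞, ε ≠ ⊤ ∧ δ ≠ ⊤ ∧ ε ∈ ssSet X ∧ δ ∈ ssSet Y ∧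
        CoarselyEquivalent ↥(comp X ε x₀) ↥(comp Y δ y₀) ∧
        (LargeScaleConnected X ↔ LargeScaleConnected Y))) ∧
    (CoarselyEquivalent X Y ↔
      (∀ ε δ : ℝ≥0∞, ε ≠ ⊤ → δ ≠ ⊤ → ε ∈ ssSet X → δ ∈ ssSet Y →
        (CoarselyEquivalent ↥(comp X ε x₀) ↥(comp Y δ y₀) ∧
          (LargeScaleConnected X ↔ LargeScaleConnected Y)))) := by
  obtain ⟨ε₀, hε₀, hε₀X⟩ := exists_mem_ssSet hsX
  obtain ⟨δ₀, hδ₀, hδ₀Y⟩ := exists_mem_ssSet hsY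
  have hall : CoarselyEquivalent X Y → ∀ ε δ : ℝ≥0∞, ε ≠ ⊤ → δ ≠ ⊤ → ε ∈ ssSet X → δ ∈ ssSet Y →
      (CoarselyEquivalent ↥(comp X ε x₀) ↥(comp Y δ y₀) ∧
        (LargeScaleConnected X ↔ LargeScaleConnected Y)) := fun h ε δ hε hδ hεX hδY =>
    ⟨h.comp_of_shiftHomogeneous hX hY hε hδ hεX hδY x₀ y₀,
      .of_coarselyEquivalent h, .of_coarselyEquivalent h.symm⟩
  refine ⟨⟨fun h => ⟨ε₀, δ₀, hε₀, hδ₀, hε₀X, hδ₀Y, hall h ε₀ δ₀ hε₀ hδ₀ hε₀X hδ₀Y⟩, ?_⟩,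
    hall, fun h => ?_⟩
  · rintro ⟨ε, δ, hε, hδ, hεX, hδY, h, hconn⟩
    exact .of_comp hX hY hε hδ hεX hδY h hconn
  · obtain ⟨hcomp, hconn⟩ := h ε₀ δ₀ hε₀ hδ₀ hε₀X hδ₀Y
    exact .of_comp hX hY hε₀ hδ₀ hε₀X hδ₀Y hcomp hconn

end
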